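/- arXiv:1702.03219 — 6 statements merged into one kernel-verified Lean document; each statement's English description precedes it below -/
import Mathlib

section
/- Let n ≥ 1, let K be an n×n complex matrix each of whose columns has at most one nonzero entry, and let v : Fin n → ℂ. Then the cardinality of the support of K.mulVec v is at most the cardinality of the support of v. -/
open Finset Matrix

/-- the coherence rank (cardinality of the support of a vector)
is non-increasing under an incoherent Kraus operator, i.e. a matrix each of
whose columns has at most one nonzero entry. -/
theorem coherenceRank_mulVec_le
    (n : ℕ) (hn : 1 ≤ n) (K : Matrix (Fin n) (Fin n) ℂ)
    (hK : ∀ j i i', K i j ≠ 0 → K i' j ≠ 0 → i = i')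
    (v : Fin n → ℂ) :
    (Finset.univ.filter (fun i => K.mulVec v i ≠ 0)).card
      ≤ (Finset.univ.filter (fun i => v i ≠ 0)).card := by
  refine Finset.card_le_card_of_forall_subsingleton (fun i j => K i j ≠ 0) ?_ ?_
  · intro i hi
    have hsum : ∑ j, K i j * v j ≠ 0 := (Finset.mem_filter.mp hi).2
    obtain ⟨j, -, hj⟩ := Finset.exists_ne_zero_of_sum_ne_zero hsum
    exact ⟨j, by simpa using right_ne_zero_of_mul hj, left_ne_zero_of_mul hj⟩
  · rintro j - i ⟨-, hi⟩ i' ⟨-, hi'⟩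
    exact hK j i i' hi hi'
end

section
/- Let d ≥ 1, let K be a complex matrix indexed by (Fin d × Fin d) × (Fin d × Fin d) each of whose columns has at most one nonzero entry, and let v : Fin d → ℂ. Let u = K.mulVec w where w : Fin d × Fin d → ℂ is defined by w (i, j) = v i if j = 0 and w (i, j) = 0 otherwise, and let W be the d×d matrix with W i j = u (i, j). Then the rank of W is at most the cardinality of the support of v. -/
open Finset Matrix

/-- the Schmidt rank generated from a pure state `v` through an
incoherent Kraus operator `K` (each column has at most one nonzero entry),
after appending the incoherent ancilla state `|0⟩`, is at most the coherence
rank of `v`: reshaping `u = K (v ⊗ |0⟩)` as a matrix `W`, one has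
`rank W ≤ card (support v)`. -/
theorem schmidtRank_le_coherenceRank
    (d : ℕ) (hd : 1 ≤ d)
    (K : Matrix (Fin d × Fin d) (Fin d × Fin d) ℂ)
    (hK : ∀ j i i', K i j ≠ 0 → K i' j ≠ 0 → i = i')
    (v : Fin d → ℂ)
    (w : Fin d × Fin d → ℂ)
    (hw : ∀ p : Fin d × Fin d, w p = if p.2 = ⟨0, hd⟩ then v p.1 else 0)
    (u : Fin d × Fin d → ℂ) (hu : u = K.mulVec w)
    (W : Matrix (Fin d) (Fin d) ℂ) (hW : ∀ i j, W i j = u (i, j)) :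
    W.rank ≤ (Finset.univ.filter (fun i => v i ≠ 0)).card := by
  have hf : ∀ s, ∃ p, ∀ q, q ≠ p → K q (s, ⟨0, hd⟩) = 0 := by
    intro s
    by_cases h : ∃ p, K p (s, ⟨0, hd⟩) ≠ 0
    · obtain ⟨p, hp⟩ := h
      exact ⟨p, fun q hq => by_contra fun hne => hq (hK _ _ _ hne hp)⟩
    · push Not at h
      exact ⟨(s, s), fun q _ => h q⟩
  choose f hf using hf
  let S := {i // v i ≠ 0}
  let A : Matrix (Fin d) S ℂ := .of fun i s =>
    if i = (f s).1 then K (f s) (s, ⟨0, hd⟩) * v s else 0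
  let B : Matrix S (Fin d) ℂ := .of fun s j => if j = (f s).2 then 1 else 0
  have hAB : W = A * B := by
    ext i j
    have hterm : ∀ s : S, A i s * B s j = K (i, j) (s, ⟨0, hd⟩) * v s := by
      intro s
      by_cases h : (i, j) = f s
      · simp [A, B, ← h]
      · rw [hf s _ h, zero_mul]
        by_cases hi : i = (f s).1
        · have hj : j ≠ (f s).2 := fun hj => h (Prod.ext hi hj)
          simp [B, hj]
        · simp [A, hi]
    rw [hW, hu, Matrix.mul_apply, Finset.sum_congr rfl fun s _ => hterm s]
    have hsum : K.mulVec w (i, j) = ∑ s, K (i, j) (s, ⟨0, hd⟩) * v s := by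
      simp only [Matrix.mulVec, dotProduct, Fintype.sum_prod_type, hw, mul_ite, mul_zero,
        Finset.sum_ite_eq', Finset.mem_univ, if_true]
    rw [hsum, ← Finset.sum_filter_of_ne (p := fun s => v s ≠ 0)
      fun s _ h => right_ne_zero_of_mul h]
    exact Finset.sum_subtype _ (by simp) _
  calc W.rank ≤ A.rank := hAB ▸ Matrix.rank_mul_le_left A B
    _ ≤ Fintype.card S := A.rank_le_card_width
    _ = _ := Fintype.card_subtype _
end

section
/- Let d ≥ 1 and 1 ≤ k, let K be a complex matrix indexed by (Fin d × Fin d) × (Fin d × Fin d) each of whose columns has at most one nonzero entry, and let v : Fin d → ℂ with card (support v) < k. Let u = K.mulVec w where w (i, j) = v i if j = 0 and w (i, j) = 0 otherwise, and let W be the d×d matrix with W i j = u (i, j). Then every k×k minor of W vanishes: for all k-element subsets s, t of Fin d, det(W restricted to rows s and columns t) = 0. -/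
open Finset Matrix

/-- A square matrix with nonzero determinant has a transversal of nonzero entries. -/
theorem Matrix.exists_perm_forall_ne_zero_of_det_ne_zero {n R : Type*} [Fintype n]
    [DecidableEq n] [CommRing R] {M : Matrix n n R} (hM : M.det ≠ 0) :
    ∃ σ : Equiv.Perm n, ∀ i, M (σ i) i ≠ 0 := by
  contrapose! hM
  rw [Matrix.det_apply]
  refine Finset.sum_eq_zero fun σ _ => ?_
  obtain ⟨i, hi⟩ := hM σ
  rw [Finset.prod_eq_zero (f := fun j => M (σ j) j) (Finset.mem_univ i) hi, smul_zero]

/-- if a pure state `v` has coherence rank (support cardinality)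
less than `k`, then after applying any incoherent Kraus operator `K` (each
column has at most one nonzero entry) to `v ⊗ |0⟩` and reshaping the result
as a matrix `W`, every k×k minor of `W` vanishes. -/
theorem minors_vanish_of_coherenceRank_lt
    (d k : ℕ) (hd : 1 ≤ d) (hk : 1 ≤ k)
    (K : Matrix (Fin d × Fin d) (Fin d × Fin d) ℂ)
    (hK : ∀ j i i', K i j ≠ 0 → K i' j ≠ 0 → i = i')
    (v : Fin d → ℂ)
    (hv : (Finset.univ.filter (fun i => v i ≠ 0)).card < k)
    (w : Fin d × Fin d → ℂ)
    (hw : ∀ p : Fin d × Fin d, w p = if p.2 = ⟨0, hd⟩ then v p.1 else 0)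
    (u : Fin d × Fin d → ℂ) (hu : u = K.mulVec w)
    (W : Matrix (Fin d) (Fin d) ℂ) (hW : ∀ i j, W i j = u (i, j)) :
    ∀ (s t : Finset (Fin d)) (hs : s.card = k) (ht : t.card = k),
      (W.submatrix (s.orderEmbOfFin hs) (t.orderEmbOfFin ht)).det = 0 := by
  intro s t hs ht
  by_contra hdet
  obtain ⟨σ, hσ⟩ := Matrix.exists_perm_forall_ne_zero_of_det_ne_zero hdet
  have hcol : ∀ x, ∃ a, v a ≠ 0 ∧
      K (s.orderEmbOfFin hs (σ x), t.orderEmbOfFin ht x) (a, ⟨0, hd⟩) ≠ 0 := by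
    intro x
    have hx := hσ x
    rw [Matrix.submatrix_apply, hW, hu, Matrix.mulVec, dotProduct] at hx
    obtain ⟨⟨a, b⟩, -, hab⟩ := Finset.exists_ne_zero_of_sum_ne_zero hx
    have hwab := right_ne_zero_of_mul hab
    rw [hw] at hwab
    obtain ⟨rfl, hva⟩ := ite_ne_right_iff.mp hwab
    exact ⟨a, hva, left_ne_zero_of_mul hab⟩
  choose a hva hKa using hcol
  have ha : Function.Injective a := by
    intro x y hxy
    have hy := hKa y
    rw [← hxy] at hy
    exact (t.orderEmbOfFin ht).injective (Prod.ext_iff.mp (hK _ _ _ (hKa x) hy)).2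
  have hcard := Finset.card_le_card_of_injOn (s := Finset.univ)
    (t := Finset.univ.filter fun i => v i ≠ 0) a (fun x _ => by simpa using hva x) ha.injOn
  rw [Finset.card_univ, Fintype.card_fin] at hcard
  exact hcard.not_gt hv
end

section
/- Let d ≥ 1, let ρ be a d×d positive semidefinite complex matrix, and let K be a d×d complex matrix each of whose columns has at most one nonzero entry. Define the coherence number r_C(σ) of a positive semidefinite matrix σ as the infimum, over all finite families of vectors (ψ_a)_{a} with σ = ∑_a ψ_a ψ_aᴴ (where ψ_a ψ_aᴴ denotes the rank-one matrix vecMulVec ψ_a (conj ψ_a)), of the maximum over a of card (support ψ_a). Then r_C(K ρ Kᴴ) ≤ r_C(ρ). -/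
open Finset Matrix ComplexOrder

/-- The coherence number of a positive semidefinite matrix `σ`: the infimum,
over all finite families of vectors `(ψ_a)` with `σ = ∑ a, ψ_a ψ_aᴴ`, of the
maximal coherence rank (support cardinality) of the `ψ_a`. -/
noncomputable def cohNum (d : ℕ) (σ : Matrix (Fin d) (Fin d) ℂ) : ℕ :=
  sInf { n : ℕ | ∃ (m : ℕ) (ψ : Fin m → Fin d → ℂ),
    σ = ∑ a, Matrix.vecMulVec (ψ a) (star (ψ a)) ∧
    n = Finset.univ.sup
      (fun a => (Finset.univ.filter (fun i => ψ a i ≠ 0)).card) }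

/-- A matrix with at most one nonzero entry in each column does not increase the support
cardinality of a vector. -/
theorem card_support_mulVec_le {m n R : Type*} [Fintype m] [Fintype n]
    [NonUnitalNonAssocSemiring R] [DecidableEq R] (K : Matrix m n R)
    (hK : ∀ j i i', K i j ≠ 0 → K i' j ≠ 0 → i = i') (v : n → R) :
    #{i | (K *ᵥ v) i ≠ 0} ≤ #{j | v j ≠ 0} := by
  have key : ∀ i, (K *ᵥ v) i ≠ 0 → ∃ j, v j ≠ 0 ∧ K i j ≠ 0 := by
    intro i hi
    obtain ⟨j, -, hj⟩ := Finset.exists_ne_zero_of_sum_ne_zero hi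
    exact ⟨j, right_ne_zero_of_mul hj, left_ne_zero_of_mul hj⟩
  refine Finset.card_le_card_of_forall_subsingleton (fun i j => K i j ≠ 0) ?_ ?_
  · intro i hi
    obtain ⟨j, hv, hKj⟩ := key i (by simpa using hi)
    exact ⟨j, by simpa using hv, hKj⟩
  · rintro j - i ⟨-, hi⟩ i' ⟨-, hi'⟩
    exact hK j i i' hi hi'

/-- A positive semidefinite matrix is a finite sum of rank-one matrices `ψ ψᴴ`. -/
theorem Matrix.PosSemidef.exists_eq_sum_vecMulVec_star {d : ℕ}
    {ρ : Matrix (Fin d) (Fin d) ℂ} (hρ : ρ.PosSemidef) :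
    ∃ ψ : Fin d → Fin d → ℂ, ρ = ∑ a, vecMulVec (ψ a) (star (ψ a)) := by
  obtain ⟨B, rfl⟩ : ∃ B : Matrix (Fin d) (Fin d) ℂ, ρ = Bᴴ * B := by
    open scoped MatrixOrder in
    exact CStarAlgebra.nonneg_iff_eq_star_mul_self.mp hρ.nonneg
  refine ⟨fun a => star (B a), ?_⟩
  ext i j
  simp [Matrix.mul_apply, Matrix.sum_apply, vecMulVec_apply]

/-- strong monotonicity of the coherence number under incoherent
Kraus operators: for positive semidefinite `ρ` and a matrix `K` each of whose
columns has at most one nonzero entry, `r_C(K ρ Kᴴ) ≤ r_C(ρ)`. -/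
theorem cohNum_conj_le
    (d : ℕ) (hd : 1 ≤ d)
    (ρ : Matrix (Fin d) (Fin d) ℂ) (hρ : ρ.PosSemidef)
    (K : Matrix (Fin d) (Fin d) ℂ)
    (hK : ∀ j i i', K i j ≠ 0 → K i' j ≠ 0 → i = i') :
    cohNum d (K * ρ * Kᴴ) ≤ cohNum d ρ := by
  obtain ⟨φ, hφ⟩ := hρ.exists_eq_sum_vecMulVec_star
  obtain ⟨m, ψ, hψ, hn⟩ : cohNum d ρ ∈ _ := Nat.sInf_mem ⟨_, d, φ, hφ, rfl⟩
  rw [hn]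
  refine le_trans (Nat.sInf_le ⟨m, fun a => K *ᵥ ψ a, ?_, rfl⟩)
    (Finset.sup_mono_fun fun a _ => card_support_mulVec_le K hK (ψ a))
  simp only [hψ, Matrix.mul_sum, Matrix.sum_mul, mul_vecMulVec, vecMulVec_mul, star_mulVec]
end

section
/- For every ε with 0 < ε < 1, the Specht ratio satisfies S(ε) = (1/e) · ((ε² − 1)·ε^(2ε²/(ε²−1))) / (2ε² · log ε) ≤ 1/ε². -/
open Real

/-- If `t ≤ u ≤ 1` then `u * exp (t / u - 1) ≤ 1`. -/
lemma mul_exp_div_sub_one_le_one {t u : ℝ} (hu : 0 < u) (htu : t ≤ u) (hu1 : u ≤ 1) :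
    u * exp (t / u - 1) ≤ 1 := by
  have hexp : t / u - 1 ≤ 1 - u := by
    rw [sub_le_iff_le_add, div_le_iff₀ hu]
    nlinarith
  calc u * exp (t / u - 1) ≤ exp (u - 1) * exp (1 - u) := by
        gcongr
        linarith [add_one_le_exp (u - 1)]
    _ = 1 := by rw [← exp_add]; simp

/-- the Specht ratio bound
`S(ε) = (1/e)·((ε²−1)·ε^(2ε²/(ε²−1)))/(2ε²·log ε) ≤ 1/ε²` for `0 < ε < 1`. -/
theorem specht_ratio_le
    (ε : ℝ) (hε0 : 0 < ε) (hε1 : ε < 1) :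
    (1 / Real.exp 1) *
        ((ε ^ 2 - 1) * ε ^ (2 * ε ^ 2 / (ε ^ 2 - 1))) /
        (2 * ε ^ 2 * Real.log ε)
      ≤ 1 / ε ^ 2 := by
  have ht0 : 0 < ε ^ 2 := by positivity
  have ht1 : ε ^ 2 - 1 < 0 := by nlinarith
  have hlog : log ε < 0 := log_neg hε0 hε1
  have hlog2 : log (ε ^ 2) = 2 * log ε := by simp
  have hupper := log_le_sub_one_of_pos ht0
  have hlower := one_sub_inv_le_log_of_pos ht0
  rw [hlog2] at hupper hlower
  have hmul : ε ^ 2 - 1 ≤ ε ^ 2 * (2 * log ε) := by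
    calc ε ^ 2 - 1 = ε ^ 2 * (1 - (ε ^ 2)⁻¹) := by field_simp
      _ ≤ ε ^ 2 * (2 * log ε) := by gcongr
  have hneg : 2 * log ε < 0 := by linarith
  have key := mul_exp_div_sub_one_le_one (t := ε ^ 2) (u := (ε ^ 2 - 1) / (2 * log ε))
    (div_pos_of_neg_of_neg ht1 hneg) ((le_div_iff_of_neg hneg).2 hmul)
    ((div_le_one_of_neg hneg).2 hupper)
  have hpow : ε ^ (2 * ε ^ 2 / (ε ^ 2 - 1)) =
      exp (ε ^ 2 / ((ε ^ 2 - 1) / (2 * log ε))) := by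
    rw [rpow_def_of_pos hε0, div_div_eq_mul_div]
    ring_nf
  have hlog_ne := hlog.ne
  rw [hpow]
  calc _ = (ε ^ 2 - 1) / (2 * log ε) *
        exp (ε ^ 2 / ((ε ^ 2 - 1) / (2 * log ε)) - 1) / ε ^ 2 := by
        rw [exp_sub]
        generalize exp (ε ^ 2 / ((ε ^ 2 - 1) / (2 * log ε))) = x
        field_simp
    _ ≤ 1 / ε ^ 2 := by gcongr
end

section
/- Let N, m be natural numbers with 1 ≤ m < N, and define f : ℝ → ℝ by f(α) = N · ((sin α)²/m)^(m/N) · ((cos α)²/(N−m))^((N−m)/N). Then f is antitone on the interval [arcsin √(m/N), π/2]; moreover f(arcsin √(m/N)) = 1 and f(π/2) = 0. -/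
open Real Set

/-- For a weight `p ∈ (0, 1]`, the weighted geometric mean `x ^ p * (1 - x) ^ (1 - p)` is
decreasing in `x` on `[p, 1]`. -/
theorem antitoneOn_rpow_mul_one_sub_rpow {p : ℝ} (hp : 0 < p) (hp1 : p ≤ 1) :
    AntitoneOn (fun x : ℝ => x ^ p * (1 - x) ^ (1 - p)) (Set.Icc p 1) := by
  rintro x ⟨hpx, hx1⟩ y ⟨-, hy1⟩ hxy
  rcases hx1.eq_or_lt with rfl | hx1
  · rw [le_antisymm hy1 hxy]
  have hx : 0 < x := hp.trans_le hpx
  have hx' : 0 < 1 - x := sub_pos.2 hx1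
  have hy : 0 ≤ y := hx.le.trans hxy
  have hy' : 0 ≤ 1 - y := sub_nonneg.2 hy1
  have amgm := Real.geom_mean_le_arith_mean2_weighted hp.le (sub_nonneg.2 hp1)
    (div_nonneg hy hx.le) (div_nonneg hy' hx'.le) (add_sub_cancel p 1)
  have mean_le_one : p * (y / x) + (1 - p) * ((1 - y) / (1 - x)) ≤ 1 := by
    have key : 1 - (p * (y / x) + (1 - p) * ((1 - y) / (1 - x))) =
        (y - x) * (x - p) / (x * (1 - x)) := by
      field_simp
      ring
    have := div_nonneg (mul_nonneg (sub_nonneg.2 hxy) (sub_nonneg.2 hpx)) (mul_pos hx hx').le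
    linarith
  have h := amgm.trans mean_le_one
  rwa [Real.div_rpow hy hx.le, Real.div_rpow hy' hx'.le, div_mul_div_comm,
    div_le_one (by positivity)] at h

/-- in Grover's search with `N` items and `m` targets, the
coherence N-concurrence
`f(α) = N·((sin α)²/m)^(m/N)·((cos α)²/(N−m))^((N−m)/N)`
is antitone on `[arcsin √(m/N), π/2]`, equals `1` at `α = arcsin √(m/N)`
and equals `0` at `α = π/2`. -/
theorem grover_coherence_concurrence_antitone
    (N m : ℕ) (hm : 1 ≤ m) (hmN : m < N) :
    AntitoneOn
      (fun α : ℝ => (N : ℝ) * ((Real.sin α) ^ 2 / (m : ℝ)) ^ ((m : ℝ) / (N : ℝ)) *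
        ((Real.cos α) ^ 2 / ((N : ℝ) - (m : ℝ))) ^ (((N : ℝ) - (m : ℝ)) / (N : ℝ)))
      (Set.Icc (Real.arcsin (Real.sqrt ((m : ℝ) / (N : ℝ)))) (Real.pi / 2))
    ∧ (N : ℝ) * ((Real.sin (Real.arcsin (Real.sqrt ((m : ℝ) / (N : ℝ))))) ^ 2 / (m : ℝ)) ^ ((m : ℝ) / (N : ℝ)) *
        ((Real.cos (Real.arcsin (Real.sqrt ((m : ℝ) / (N : ℝ))))) ^ 2 / ((N : ℝ) - (m : ℝ))) ^ (((N : ℝ) - (m : ℝ)) / (N : ℝ)) = 1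
    ∧ (N : ℝ) * ((Real.sin (Real.pi / 2)) ^ 2 / (m : ℝ)) ^ ((m : ℝ) / (N : ℝ)) *
        ((Real.cos (Real.pi / 2)) ^ 2 / ((N : ℝ) - (m : ℝ))) ^ (((N : ℝ) - (m : ℝ)) / (N : ℝ)) = 0 := by
  have hm0 : (0 : ℝ) < m := by exact_mod_cast hm
  have hmN' : (m : ℝ) < N := by exact_mod_cast hmN
  have hN0 : (0 : ℝ) < N := hm0.trans hmN'
  have hd : (0 : ℝ) < N - m := sub_pos.2 hmN'
  have hq : ((N : ℝ) - m) / N = 1 - m / N := by rw [sub_div, div_self hN0.ne']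
  have hp0 : (0 : ℝ) < m / N := div_pos hm0 hN0
  have hp1 : (m : ℝ) / N < 1 := (div_lt_one hN0).2 hmN'
  have sin_start : Real.sin (Real.arcsin (Real.sqrt ((m : ℝ) / N))) = Real.sqrt ((m : ℝ) / N) :=
    Real.sin_arcsin (by linarith [Real.sqrt_nonneg ((m : ℝ) / N)]) (Real.sqrt_le_one.2 hp1.le)
  refine ⟨?_, ?_, ?_⟩
  · rintro a ⟨ha, ha'⟩ b ⟨-, hb'⟩ hab
    have ha0 : 0 ≤ a := (Real.arcsin_nonneg.2 (Real.sqrt_nonneg _)).trans ha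
    have hsqrt : Real.sqrt ((m : ℝ) / N) ≤ Real.sin a := by
      rw [← sin_start]
      exact Real.sin_le_sin_of_le_of_le_pi_div_two (Real.neg_pi_div_two_le_arcsin _) ha' ha
    have hsin : Real.sin a ≤ Real.sin b :=
      Real.sin_le_sin_of_le_of_le_pi_div_two (by linarith [Real.pi_pos]) hb' hab
    have hsin0 : 0 ≤ Real.sin a := (Real.sqrt_nonneg _).trans hsqrt
    have hpa : (m : ℝ) / N ≤ Real.sin a ^ 2 := (Real.sqrt_le_left hsin0).1 hsqrt
    have hsq : Real.sin a ^ 2 ≤ Real.sin b ^ 2 := pow_le_pow_left₀ hsin0 hsin 2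
    have h := antitoneOn_rpow_mul_one_sub_rpow hp0 hp1.le
      ⟨hpa, Real.sin_sq_le_one a⟩ ⟨hpa.trans hsq, Real.sin_sq_le_one b⟩ hsq
    simp only [← Real.cos_sq', ← hq] at h
    simp only [Real.div_rpow (sq_nonneg _) hm0.le, Real.div_rpow (sq_nonneg _) hd.le,
      mul_assoc, div_mul_div_comm]
    gcongr
  · rw [Real.cos_sq', sin_start, Real.sq_sqrt hp0.le, ← hq, div_div_cancel_left' hm0.ne',
      div_div_cancel_left' hd.ne', mul_assoc, ← Real.rpow_add (inv_pos.2 hN0), hq,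
      add_sub_cancel, Real.rpow_one, mul_inv_cancel₀ hN0.ne']
  · have hq0 : ((N : ℝ) - m) / N ≠ 0 := (div_pos hd hN0).ne'
    simp [Real.zero_rpow hq0]
end
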